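/- If X ⊆ ℝ^m × ℝ^k is a compact algebraic set whose projection to ℝ^m equals a set K, and X has the minimal number of connected components among all compact algebraic sets (in any ℝ^m × ℝ^j) projecting onto K, and K is connected, then X is connected; consequently every connected component of X projects onto all of K. -/

import Mathlib

open MvPolynomial

open Topology Set

theorem MvPolynomial.contDiff_eval {σ : Type*} [Fintype σ] (p : MvPolynomial σ ℝ) :
    ContDiff ℝ 1 fun x : σ → ℝ => eval x p := by
  induction p using MvPolynomial.induction_on with
  | C a => simpa using contDiff_const
  | add p q hp hq => simpa using hp.add hq
  | mul_X p i hp => simpa using hp.mul (contDiff_apply ℝ ℝ i)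

theorem MvPolynomial.hasDerivAt_eval_of_derivation {σ : Type*}
    (D : Derivation ℝ (MvPolynomial σ ℝ) (MvPolynomial σ ℝ)) {α : ℝ → σ → ℝ} {t : ℝ}
    (hα : ∀ i, HasDerivAt (fun s => α s i) (eval (α t) (D (X i))) t) (p : MvPolynomial σ ℝ) :
    HasDerivAt (fun s => eval (α s) p) (eval (α t) (D p)) t := by
  induction p using MvPolynomial.induction_on with
  | C a => simpa using hasDerivAt_const t a
  | add p q hp hq => simpa using! hp.add hq
  | mul_X p i hp =>
    have := hp.mul (hα i)
    simp only [map_mul, eval_X, Derivation.leibniz, map_add, smul_eq_mul]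
    convert! this using 1
    ring

/-- An ideal stable under a polynomial vector field has a zero locus that is locally stable under
its flow. -/
theorem MvPolynomial.exists_curve_mem_zeroLocus {σ : Type*} [Fintype σ]
    {I : Ideal (MvPolynomial σ ℝ)} (D : Derivation ℝ (MvPolynomial σ ℝ) (MvPolynomial σ ℝ))
    (hD : ∀ p ∈ I, D p ∈ I) {x : σ → ℝ} (hx : x ∈ zeroLocus ℝ I) :
    ∃ α : ℝ → σ → ℝ, α 0 = x ∧ ∀ᶠ t in 𝓝 0,
      α t ∈ zeroLocus ℝ I ∧ HasDerivAt α (fun i => eval (α t) (D (X i))) t := by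
  obtain ⟨S, hS⟩ := (isNoetherianRing_iff_ideal_fg _).1 inferInstance I
  have hSI : ∀ g : S, (g : MvPolynomial σ ℝ) ∈ I := fun g => hS ▸ Ideal.subset_span g.2
  have hcoef : ∀ g : S, ∃ a : S → MvPolynomial σ ℝ, ∑ l, a l * l = D g := by
    intro g
    have hg := hD g (hSI g)
    rw [← hS] at hg
    obtain ⟨a, ha⟩ := Submodule.mem_span_finset'.1 hg
    exact ⟨a, by simpa using ha⟩
  choose a ha using hcoef
  have hF : ContDiff ℝ 1 fun y : σ → ℝ => fun i => eval y (D (X i)) :=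
    contDiff_pi.2 fun i => contDiff_eval _
  obtain ⟨α, hα0, ε, hε, hα⟩ :=
    (hF.contDiffAt (x := x)).exists_forall_mem_closedBall_exists_eq_forall_mem_Ioo_hasDerivAt₀ 0
  have hαev : ∀ᶠ t in 𝓝 (0 : ℝ), HasDerivAt α (fun i => eval (α t) (D (X i))) t := by
    filter_upwards [Ioo_mem_nhds (show (0 : ℝ) - ε < 0 by linarith)
      (show (0 : ℝ) < 0 + ε by linarith)] with t ht using hα t ht
  -- The generators of `I` along `α` solve a linear system; compare with its zero solution.
  let w : (σ → ℝ) × (S → ℝ) → (σ → ℝ) × (S → ℝ) := fun z =>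
    (fun i => eval z.1 (D (X i)), fun g => ∑ l, eval z.1 (a g l) * z.2 l)
  have hw : ContDiff ℝ 1 w := by
    refine (hF.comp contDiff_fst).prodMk (contDiff_pi.2 fun g => ContDiff.sum fun l _ => ?_)
    exact ((contDiff_eval _).comp contDiff_fst).mul ((contDiff_apply ℝ ℝ l).comp contDiff_snd)
  let f : ℝ → (σ → ℝ) × (S → ℝ) := fun t => (α t, fun g => eval (α t) (g : MvPolynomial σ ℝ))
  let f₀ : ℝ → (σ → ℝ) × (S → ℝ) := fun t => (α t, 0)
  have hff₀ : f 0 = f₀ 0 := by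
    simp only [f, f₀, Prod.mk.injEq, true_and]
    funext g
    rw [hα0]
    simpa [aeval_eq_eval] using hx g (hSI g)
  have hf : ∀ᶠ t in 𝓝 0, HasDerivAt f (w (f t)) t := by
    filter_upwards [hαev] with t ht
    refine ht.prodMk (hasDerivAt_pi.2 fun g => ?_)
    have := hasDerivAt_eval_of_derivation D (fun i => hasDerivAt_pi.1 ht i) g
    rw [← ha g] at this
    simpa [f] using this
  have hf₀ : ∀ᶠ t in 𝓝 0, HasDerivAt f₀ (w (f₀ t)) t := by
    filter_upwards [hαev] with t ht
    refine ht.prodMk ?_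
    simpa [f₀] using! hasDerivAt_const t (0 : S → ℝ)
  obtain ⟨L, s, hs, hL⟩ := (hw.contDiffAt (x := f 0)).exists_lipschitzOnWith
  have heq := ODE_solution_unique_of_eventually (v := fun _ => w) (s := fun _ => s) (K := L)
    (Filter.Eventually.of_forall fun _ => hL)
    (hf.and (hf.self_of_nhds.continuousAt.eventually_mem hs))
    (hf₀.and (hf₀.self_of_nhds.continuousAt.eventually_mem (hff₀ ▸ hs))) hff₀
  refine ⟨α, hα0, ?_⟩
  filter_upwards [heq, hαev] with t ht htd
  refine ⟨?_, htd⟩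
  rw [← hS, zeroLocus_span]
  intro g hg
  simpa [aeval_eq_eval] using! congrFun (congrArg Prod.snd ht) ⟨g, hg⟩

theorem MvPolynomial.eval_derivation_eq_zero_of_isMinOn {σ : Type*} [Fintype σ]
    {I : Ideal (MvPolynomial σ ℝ)} (D : Derivation ℝ (MvPolynomial σ ℝ) (MvPolynomial σ ℝ))
    (hD : ∀ p ∈ I, D p ∈ I) {x : σ → ℝ} (hx : x ∈ zeroLocus ℝ I) {i : σ}
    (hmin : IsMinOn (fun y : σ → ℝ => y i) (connectedComponentIn (zeroLocus ℝ I) x) x) :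
    eval x (D (X i)) = 0 := by
  obtain ⟨α, rfl, hα⟩ := exists_curve_mem_zeroLocus D hD hx
  obtain ⟨ε, hε, h⟩ := Metric.eventually_nhds_iff_ball.1 hα
  have hsub : α '' Metric.ball 0 ε ⊆ connectedComponentIn (zeroLocus ℝ I) (α 0) := by
    refine IsPreconnected.subset_connectedComponentIn
      (((convex_ball 0 ε).isPreconnected).image _ fun t ht => (h t ht).2.continuousAt.continuousWithinAt)
      (mem_image_of_mem _ (Metric.mem_ball_self hε)) ?_
    rintro _ ⟨t, ht, rfl⟩
    exact (h t ht).1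
  have hloc : IsLocalMin (fun t => α t i) 0 := by
    filter_upwards [Metric.ball_mem_nhds 0 hε] with t ht
    exact hmin (hsub (mem_image_of_mem _ ht))
  exact hloc.hasDerivAt_eq_zero (hasDerivAt_pi.1 hα.self_of_nhds.2 i)

theorem Derivation.eq_zero_of_forall_comp_algHom_X_eq_zero {k σ F : Type*} [Field k] [Field F]
    [Algebra k F] {φ : MvPolynomial σ k →ₐ[k] F}
    (hφ : ∀ z, ∃ p q, φ q ≠ 0 ∧ z * φ q = φ p) {δ : Derivation k F F}
    (hδ : ∀ i, δ (φ (X i)) = 0) : δ = 0 := by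
  have hpoly : ∀ p, δ (φ p) = 0 := fun p => by
    induction p using MvPolynomial.induction_on with
    | C a => rw [← algebraMap_eq, AlgHom.commutes, Derivation.map_algebraMap]
    | add p q hp hq => simp [hp, hq]
    | mul_X p i hp => simp [hp, hδ]
  ext z
  obtain ⟨p, q, hq, hz⟩ := hφ z
  have := congrArg δ hz
  simpa [hpoly, hq] using this

/-- A prime ideal of a polynomial ring in characteristic zero either contains a nonzero univariate
polynomial in each variable, or is stable under a derivation that is nonzero modulo the ideal. -/
theorem MvPolynomial.exists_aeval_X_mem_or_exists_derivation {k σ : Type*} [Field k] [CharZero k]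
    [Finite σ] (I : Ideal (MvPolynomial σ k)) [I.IsPrime] :
    (∀ i, ∃ f : Polynomial k, f ≠ 0 ∧ Polynomial.aeval (X i : MvPolynomial σ k) f ∈ I) ∨
    ∃ D : Derivation k (MvPolynomial σ k) (MvPolynomial σ k),
      (∀ p ∈ I, D p ∈ I) ∧ ∃ i, D (X i) ∉ I := by
  let A := MvPolynomial σ k ⧸ I
  let F := FractionRing A
  let φ : MvPolynomial σ k →ₐ[k] F := (IsScalarTower.toAlgHom k A F).comp (Ideal.Quotient.mkₐ k I)
  have hφ : ∀ p, φ p = 0 ↔ p ∈ I := fun p =>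
    (FaithfulSMul.algebraMap_eq_zero_iff A F).trans Ideal.Quotient.eq_zero_iff_mem
  by_cases hU : Algebra.FormallyUnramified k F
  · left
    have : Algebra.IsSeparable k F := Algebra.FormallyUnramified.isSeparable k F
    intro i
    obtain ⟨f, hf, hfi⟩ := (Algebra.IsSeparable.isAlgebraic k F).isAlgebraic (φ (X i))
    exact ⟨f, hf, by rwa [← hφ, ← Polynomial.aeval_algHom_apply]⟩
  · right
    have hΩ : Nontrivial (Ω[F⁄k]) := by
      rw [← not_subsingleton_iff_nontrivial]
      exact fun h => hU ⟨h⟩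
    obtain ⟨ω, hω⟩ := exists_ne (0 : Ω[F⁄k])
    obtain ⟨l, hl⟩ := Module.Projective.exists_dual_ne_zero F hω
    let δ : Derivation k F F := l.compDer (KaehlerDifferential.D k F)
    have hδ : δ ≠ 0 := by
      intro h
      have : l = 0 := Derivation.liftKaehlerDifferential_unique l 0 (by simpa using! h)
      simp [this] at hl
    have hfrac : ∀ z, ∃ p q, φ q ≠ 0 ∧ z * φ q = φ p := by
      intro z
      obtain ⟨a, b, hb, rfl⟩ := IsFractionRing.div_surjective (A := A) z
      obtain ⟨p, rfl⟩ := Ideal.Quotient.mk_surjective a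
      obtain ⟨q, rfl⟩ := Ideal.Quotient.mk_surjective b
      have hq : φ q ≠ 0 := by
        rw [Ne, hφ, ← Ideal.Quotient.eq_zero_iff_mem]
        exact nonZeroDivisors.ne_zero hb
      exact ⟨p, q, hq, div_mul_cancel₀ _ hq⟩
    obtain ⟨b, hb⟩ := IsLocalization.exist_integer_multiples_of_finite (nonZeroDivisors A)
      fun i => δ (φ (X i))
    let e : F := algebraMap A F b
    have he : e ≠ 0 := (FaithfulSMul.algebraMap_eq_zero_iff A F).not.2 (nonZeroDivisors.ne_zero b.2)
    have hlift : ∀ i, ∃ c, φ c = e * δ (φ (X i)) := by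
      intro i
      obtain ⟨y, hy⟩ := hb i
      obtain ⟨c, rfl⟩ := Ideal.Quotient.mk_surjective y
      exact ⟨c, hy.trans (Algebra.smul_def _ _)⟩
    choose c hc using hlift
    have hD : ∀ p, φ (mkDerivation k c p) = e * δ (φ p) := fun p => by
      induction p using MvPolynomial.induction_on with
      | C a =>
        simp only [← algebraMap_eq, AlgHom.commutes, Derivation.map_algebraMap, map_zero, mul_zero]
      | add p q hp hq => simp [hp, hq, mul_add]
      | mul_X p i hp =>
        simp only [Derivation.leibniz, mkDerivation_X, map_add, map_mul, smul_eq_mul, hp, hc]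
        ring
    refine ⟨mkDerivation k c, fun p hp => ?_, ?_⟩
    · rw [← hφ, hD, (hφ p).2 hp, map_zero, mul_zero]
    · by_contra! h
      refine hδ (Derivation.eq_zero_of_forall_comp_algHom_X_eq_zero hfrac fun i => ?_)
      have := (hφ _).2 (h i)
      rw [mkDerivation_X, hc] at this
      exact (mul_eq_zero.1 this).resolve_left he

/-- Every point of `V` shares its connected component in `V` with a point of some finite set. -/
def FinitelyManyComponents {E : Type*} [TopologicalSpace E] (V : Set E) : Prop :=
  ∃ S : Set E, S.Finite ∧ ∀ x ∈ V, ∃ s ∈ S, s ∈ connectedComponentIn V x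

theorem FinitelyManyComponents.of_meets {E : Type*} [TopologicalSpace E] {V W : Set E}
    (hW : FinitelyManyComponents W) (hWV : W ⊆ V)
    (h : ∀ x ∈ V, ∃ y ∈ W, y ∈ connectedComponentIn V x) : FinitelyManyComponents V := by
  obtain ⟨S, hS, hSW⟩ := hW
  refine ⟨S, hS, fun x hx => ?_⟩
  obtain ⟨y, hy, hyx⟩ := h x hx
  obtain ⟨s, hs, hsy⟩ := hSW y hy
  refine ⟨s, hs, ?_⟩
  rw [connectedComponentIn_eq hyx]
  exact connectedComponentIn_mono y hWV hsy

theorem FinitelyManyComponents.union {E : Type*} [TopologicalSpace E] {V W : Set E}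
    (hV : FinitelyManyComponents V) (hW : FinitelyManyComponents W) :
    FinitelyManyComponents (V ∪ W) := by
  obtain ⟨S, hS, hSV⟩ := hV
  obtain ⟨T, hT, hTW⟩ := hW
  refine ⟨S ∪ T, hS.union hT, ?_⟩
  rintro x (hx | hx)
  · obtain ⟨s, hs, hsx⟩ := hSV x hx
    exact ⟨s, .inl hs, connectedComponentIn_mono x subset_union_left hsx⟩
  · obtain ⟨s, hs, hsx⟩ := hTW x hx
    exact ⟨s, .inr hs, connectedComponentIn_mono x subset_union_right hsx⟩

theorem Set.Finite.finitelyManyComponents {E : Type*} [TopologicalSpace E] {V : Set E}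
    (hV : V.Finite) : FinitelyManyComponents V :=
  ⟨V, hV, fun x hx => ⟨x, hx, mem_connectedComponentIn hx⟩⟩

theorem FinitelyManyComponents.finite_connectedComponents {E : Type*} [TopologicalSpace E]
    {V : Set E} (hV : FinitelyManyComponents V) : Finite (ConnectedComponents V) := by
  obtain ⟨S, hS, hSV⟩ := hV
  have : Finite S := hS
  choose f hfS hf using fun x : V => hSV x x.2
  refine Finite.of_injective (fun c : ConnectedComponents V =>
    (⟨f c.out, hfS _⟩ : S)) fun c d h => ?_
  have hcd : f (Quotient.out c) = f (Quotient.out d) := congrArg Subtype.val h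
  rw [← Quotient.out_eq c, ← Quotient.out_eq d]
  refine ConnectedComponents.coe_eq_coe.2 ?_
  have h1 := hf (Quotient.out c)
  have h2 := hf (Quotient.out d)
  rw [← hcd] at h2
  have h3 := (connectedComponentIn_eq h1).trans (connectedComponentIn_eq h2).symm
  rw [connectedComponentIn_eq_image (Quotient.out c).2,
    connectedComponentIn_eq_image (Quotient.out d).2] at h3
  exact Subtype.val_injective.image_injective h3

theorem MvPolynomial.isClosed_zeroLocus {σ : Type*} (I : Ideal (MvPolynomial σ ℝ)) :
    IsClosed (zeroLocus ℝ I) := by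
  have : zeroLocus ℝ I = ⋂ p ∈ I, {x | eval x p = 0} := by
    ext x
    simp [aeval_eq_eval]
  rw [this]
  exact isClosed_biInter fun p _ => isClosed_eq (MvPolynomial.continuous_eval p) continuous_const

theorem IsCompact.isCompact_connectedComponentIn {E : Type*} [TopologicalSpace E]
    {V : Set E} (hV : IsCompact V) (x : E) : IsCompact (connectedComponentIn V x) := by
  by_cases hx : x ∈ V
  · rw [connectedComponentIn_eq_image hx]
    have : CompactSpace V := isCompact_iff_compactSpace.1 hV
    exact isClosed_connectedComponent.isCompact.image continuous_subtype_val
  · rw [connectedComponentIn_eq_empty hx]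
    exact isCompact_empty

theorem MvPolynomial.zeroLocus_sup_span_singleton {σ : Type*} (I : Ideal (MvPolynomial σ ℝ))
    (p : MvPolynomial σ ℝ) :
    zeroLocus ℝ (I ⊔ Ideal.span {p}) = {x ∈ zeroLocus ℝ I | eval x p = 0} := by
  have h : zeroLocus ℝ (I ⊔ Ideal.span {p}) = zeroLocus ℝ I ∩ zeroLocus ℝ (Ideal.span {p}) :=
    (zeroLocus_vanishingIdeal_galoisConnection (k := ℝ) (K := ℝ) (σ := σ)).l_sup
  rw [h, zeroLocus_span]
  ext x
  simp [aeval_eq_eval]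

/-- A compact real algebraic set has finitely many connected components. -/
theorem MvPolynomial.finitelyManyComponents_zeroLocus {σ : Type*} [Fintype σ]
    (I : Ideal (MvPolynomial σ ℝ)) (hI : IsCompact (zeroLocus ℝ I)) :
    FinitelyManyComponents (zeroLocus ℝ I) := by
  induction I using WellFoundedGT.induction with
  | ind I ih =>
  have ih_adjoin : ∀ p ∉ I, FinitelyManyComponents {x ∈ zeroLocus ℝ I | eval x p = 0} := by
    intro p hp
    rw [← zeroLocus_sup_span_singleton]
    refine ih _ (lt_of_le_of_ne le_sup_left fun h => hp ?_)
      (hI.of_isClosed_subset (isClosed_zeroLocus _) (zeroLocus_anti_mono le_sup_left))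
    rw [h]
    exact Ideal.mem_sup_right (Ideal.mem_span_singleton_self p)
  by_cases hvan : ∃ p, p ∉ I ∧ ∀ x ∈ zeroLocus ℝ I, eval x p = 0
  · obtain ⟨p, hp, hpz⟩ := hvan
    rw [← Set.sep_eq_self_iff_mem_true.2 hpz]
    exact ih_adjoin p hp
  by_cases hprime : ∃ p q, p ∉ I ∧ q ∉ I ∧ p * q ∈ I
  · obtain ⟨p, q, hp, hq, hpq⟩ := hprime
    have := (ih_adjoin p hp).union (ih_adjoin q hq)
    rwa [← Set.sep_or, Set.sep_eq_self_iff_mem_true.2] at this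
    intro x hx
    simpa [aeval_eq_eval] using hx _ hpq
  by_cases htop : I = ⊤
  · rw [htop, zeroLocus_top]
    exact Set.finite_empty.finitelyManyComponents
  push Not at hvan hprime
  have : I.IsPrime := ⟨htop, fun {p q} hpq => by
    by_contra! h
    exact hprime p q h.1 h.2 hpq⟩
  rcases exists_aeval_X_mem_or_exists_derivation I with hfin | ⟨D, hD, i, hi⟩
  · choose f hf hfI using hfin
    refine Set.Finite.finitelyManyComponents
      ((Set.Finite.pi' fun i => (f i).rootSet_finite ℝ).subset fun x hx i => ?_)
    refine (Polynomial.mem_rootSet_of_ne (hf i)).2 ?_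
    have := hx _ (hfI i)
    rwa [← Polynomial.aeval_algHom_apply, aeval_X] at this
  · refine (ih_adjoin _ hi).of_meets (Set.sep_subset _ _) fun x hx => ?_
    obtain ⟨y, hy, hmin⟩ := (hI.isCompact_connectedComponentIn x).exists_isMinOn
      ⟨x, mem_connectedComponentIn hx⟩ (continuous_apply i).continuousOn
    have hyV := connectedComponentIn_subset _ _ hy
    rw [connectedComponentIn_eq hy] at hmin
    exact ⟨y, ⟨hyV, eval_derivation_eq_zero_of_isMinOn D hD hyV hmin⟩, hy⟩

theorem FinitelyManyComponents.image {E F : Type*} [TopologicalSpace E] [TopologicalSpace F]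
    {V : Set E} (hV : FinitelyManyComponents V) {f : E → F} (hf : Continuous f) :
    FinitelyManyComponents (f '' V) := by
  obtain ⟨S, hS, hSV⟩ := hV
  refine ⟨f '' S, hS.image f, ?_⟩
  rintro _ ⟨x, hx, rfl⟩
  obtain ⟨s, hs, hsx⟩ := hSV x hx
  refine ⟨f s, mem_image_of_mem f hs, ?_⟩
  exact (isPreconnected_connectedComponentIn.image f hf.continuousOn).subset_connectedComponentIn
    (mem_image_of_mem f (mem_connectedComponentIn hx))
    (image_mono (connectedComponentIn_subset V x)) (mem_image_of_mem f hsx)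

theorem MvPolynomial.finite_connectedComponents_of_isCompact {m k : ℕ}
    (p : MvPolynomial (Fin m ⊕ Fin k) ℝ)
    (hp : IsCompact {w : (Fin m → ℝ) × (Fin k → ℝ) | eval (Sum.elim w.1 w.2) p = 0}) :
    Finite (ConnectedComponents
      {w : (Fin m → ℝ) × (Fin k → ℝ) | eval (Sum.elim w.1 w.2) p = 0}) := by
  let e : (Fin m ⊕ Fin k → ℝ) ≃ₜ (Fin m → ℝ) × (Fin k → ℝ) :=
    Homeomorph.sumArrowHomeomorphProdArrow
  have he : e '' zeroLocus ℝ (Ideal.span {p}) = {w | eval (Sum.elim w.1 w.2) p = 0} := by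
    rw [e.image_eq_preimage_symm, zeroLocus_span]
    ext w
    simp only [aeval_eq_eval, mem_singleton_iff, forall_eq]
    rfl
  rw [← he] at hp ⊢
  exact ((finitelyManyComponents_zeroLocus _ (e.isCompact_image.1 hp)).image
    e.continuous).finite_connectedComponents

/-- Attaching a connected curve that joins two distinct components lowers the number of
components. -/
theorem card_connectedComponents_lt_of_curve {A B : Type*} [TopologicalSpace A]
    [TopologicalSpace B] [Finite (ConnectedComponents A)] {f : A → B} (hf : Continuous f)
    {γ : ℝ → B} (hγ : Continuous γ) (hcover : range f ∪ range γ = univ) {P Q : A}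
    (hP : f P ∈ range γ) (hQ : f Q ∈ range γ)
    (hPQ : (P : ConnectedComponents A) ≠ (Q : ConnectedComponents A)) :
    Nat.card (ConnectedComponents B) < Nat.card (ConnectedComponents A) := by
  have hγc : ∀ {y z : B}, y ∈ range γ → z ∈ range γ →
      (y : ConnectedComponents B) = (z : ConnectedComponents B) := fun hy hz =>
    ConnectedComponents.coe_eq_coe'.2
      ((isPreconnected_range hγ).subset_connectedComponent hz hy)
  have hsurj : Function.Surjective hf.connectedComponentsMap := by
    intro c
    obtain ⟨z, rfl⟩ := ConnectedComponents.surjective_coe c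
    rcases hcover.symm ▸ mem_univ z with ⟨x, rfl⟩ | hz
    · exact ⟨x, rfl⟩
    · exact ⟨P, hγc hP hz⟩
  have : Finite (ConnectedComponents B) := Finite.of_surjective _ hsurj
  have := Fintype.ofFinite (ConnectedComponents A)
  have := Fintype.ofFinite (ConnectedComponents B)
  rw [Nat.card_eq_fintype_card, Nat.card_eq_fintype_card]
  exact Fintype.card_lt_of_surjective_not_injective _ hsurj fun h => hPQ (h (hγc hP hQ))

/-- The ellipse in the fibre over `x` with centre `c` and half axes `d` and the unit vector of the
added first coordinate. -/
noncomputable def fibreEllipse {m k : ℕ} (x : Fin m → ℝ) (c d : Fin k → ℝ) (θ : ℝ) :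
    (Fin m → ℝ) × (Fin (k + 1) → ℝ) :=
  (x, Fin.cons (Real.sin θ) (c + Real.cos θ • d))

theorem continuous_fibreEllipse {m k : ℕ} (x : Fin m → ℝ) (c d : Fin k → ℝ) :
    Continuous (fibreEllipse x c d) := by
  unfold fibreEllipse
  fun_prop

theorem image_Icc_fibreEllipse {m k : ℕ} (x : Fin m → ℝ) (c d : Fin k → ℝ) :
    fibreEllipse x c d '' Icc 0 (2 * Real.pi) = range (fibreEllipse x c d) := by
  have h : Function.Periodic (fibreEllipse x c d) (2 * Real.pi) := fun θ => by
    simp [fibreEllipse]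
  simpa using h.image_Icc Real.two_pi_pos 0

theorem exists_cos_sin_eq {s t : ℝ} (h : s ^ 2 + t ^ 2 = 1) :
    ∃ θ, Real.cos θ = s ∧ Real.sin θ = t := by
  have hn : ‖(⟨s, t⟩ : ℂ)‖ = 1 := by
    rw [Complex.norm_def, Complex.normSq_mk, ← sq, ← sq, h, Real.sqrt_one]
  refine ⟨Complex.arg ⟨s, t⟩, ?_, ?_⟩
  · rw [Complex.cos_arg (by rw [← norm_ne_zero_iff, hn]; exact one_ne_zero), hn, div_one]
  · rw [Complex.sin_arg, hn, div_one]

/-- The union of an algebraic set, placed at height zero, with an ellipse in a fibre is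
algebraic. -/
theorem MvPolynomial.exists_zeroSet_eq_union_fibreEllipse {m k : ℕ}
    (p : MvPolynomial (Fin m ⊕ Fin k) ℝ) (x : Fin m → ℝ) (c d : Fin k → ℝ) (hd : d ≠ 0) :
    ∃ q : MvPolynomial (Fin m ⊕ Fin (k + 1)) ℝ,
      {w : (Fin m → ℝ) × (Fin (k + 1) → ℝ) | eval (Sum.elim w.1 w.2) q = 0} =
        (fun w : (Fin m → ℝ) × (Fin k → ℝ) => (w.1, (Fin.cons 0 w.2 : Fin (k + 1) → ℝ))) ''
          {w | eval (Sum.elim w.1 w.2) p = 0} ∪ range (fibreEllipse x c d) := by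
  obtain ⟨i, hi⟩ := Function.ne_iff.1 hd
  let T : MvPolynomial (Fin m ⊕ Fin (k + 1)) ℝ := X (Sum.inr 0)
  let s : MvPolynomial (Fin m ⊕ Fin (k + 1)) ℝ := C (d i)⁻¹ * (X (Sum.inr i.succ) - C (c i))
  refine ⟨(rename (Sum.map id Fin.succ) p ^ 2 + T ^ 2) *
    (∑ l, (X (Sum.inl l) - C (x l)) ^ 2 +
      ∑ l : Fin k, (X (Sum.inr l.succ) - (C (c l) + s * C (d l))) ^ 2 +
      (s ^ 2 + T ^ 2 - 1) ^ 2), ?_⟩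
  have hsq : ∀ {u v : ℝ}, 0 ≤ u → 0 ≤ v → (u + v = 0 ↔ u = 0 ∧ v = 0) :=
    fun hu hv => add_eq_zero_iff_of_nonneg hu hv
  ext ⟨u, v⟩
  obtain ⟨t, v, rfl⟩ : ∃ t v', v = Fin.cons t v' := ⟨v 0, Fin.tail v, (Fin.cons_self_tail v).symm⟩
  have hcomp : (Sum.elim u (Fin.cons t v : Fin (k + 1) → ℝ)) ∘ Sum.map id Fin.succ =
      Sum.elim u v := by
    ext (_ | _) <;> simp
  simp only [mem_ofPred_eq, map_mul, mul_eq_zero, mem_union]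
  refine or_congr ?_ ?_
  · simp only [map_add, map_pow, eval_rename, hcomp, T, eval_X, Sum.elim_inr, Fin.cons_zero]
    rw [hsq (sq_nonneg _) (sq_nonneg _)]
    simp only [pow_eq_zero_iff two_ne_zero, mem_image, mem_ofPred_eq, Prod.exists, Prod.mk.injEq,
      Fin.cons_inj]
    constructor
    · rintro ⟨h, rfl⟩
      exact ⟨u, v, h, rfl, rfl, rfl⟩
    · rintro ⟨u', v', h, rfl, rfl, rfl⟩
      exact ⟨h, rfl⟩
  · simp only [map_add, map_sub, map_pow, map_sum, map_mul, map_one, T, s, eval_X, eval_C,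
      Sum.elim_inr, Sum.elim_inl, Fin.cons_zero, Fin.cons_succ]
    rw [hsq (by positivity) (by positivity), hsq (by positivity) (by positivity),
      Finset.sum_eq_zero_iff_of_nonneg fun _ _ => sq_nonneg _,
      Finset.sum_eq_zero_iff_of_nonneg fun _ _ => sq_nonneg _]
    simp only [pow_eq_zero_iff two_ne_zero, sub_eq_zero, Finset.mem_univ, true_implies, mem_range,
      fibreEllipse, Prod.mk.injEq, Fin.cons_inj]
    constructor
    · rintro ⟨⟨hu, hv⟩, h⟩
      obtain ⟨θ, hθ, hθ'⟩ := exists_cos_sin_eq h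
      refine ⟨θ, (_root_.funext hu).symm, hθ', ?_⟩
      ext l
      simp [hv l, hθ]
    · rintro ⟨θ, rfl, rfl, rfl⟩
      have hs : (d i)⁻¹ * ((c + Real.cos θ • d) i - c i) = Real.cos θ := by
        simp only [Pi.zero_apply] at hi
        simp [field]
      simp only [hs]
      simp

theorem stmt_7 (m k : ℕ) (p : MvPolynomial (Fin m ⊕ Fin k) ℝ) (K : Set (Fin m → ℝ))
    (X : Set ((Fin m → ℝ) × (Fin k → ℝ)))
    (hXdef : X = {w | eval (Sum.elim w.1 w.2) p = 0})
    (hXc : IsCompact X) (hXproj : Prod.fst '' X = K) (hK : IsConnected K)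
    (hmin : ∀ (j : ℕ) (q : MvPolynomial (Fin m ⊕ Fin j) ℝ),
      IsCompact {w : (Fin m → ℝ) × (Fin j → ℝ) | eval (Sum.elim w.1 w.2) q = 0} →
      Prod.fst '' {w : (Fin m → ℝ) × (Fin j → ℝ) | eval (Sum.elim w.1 w.2) q = 0} = K →
      Nat.card (ConnectedComponents X) ≤
        Nat.card (ConnectedComponents
          {w : (Fin m → ℝ) × (Fin j → ℝ) | eval (Sum.elim w.1 w.2) q = 0})) :
    IsConnected X ∧ ∀ w ∈ X, Prod.fst '' connectedComponentIn X w = K := by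
  suffices hX : IsPreconnected X by
    refine ⟨⟨?_, hX⟩, fun w hw => by rw [hX.connectedComponentIn hw, hXproj]⟩
    rw [← image_nonempty, hXproj]
    exact hK.nonempty
  have hfinite : Finite (ConnectedComponents X) := by
    rw [hXdef] at hXc ⊢
    exact finite_connectedComponents_of_isCompact p hXc
  rw [isPreconnected_closed_iff]
  intro t t' ht ht' hcover hne hne'
  by_contra hdisj
  have hcompact : ∀ {s : Set ((Fin m → ℝ) × (Fin k → ℝ))}, IsClosed s →
      IsClosed (Prod.fst '' (X ∩ s)) := fun hs =>
    ((hXc.inter_right hs).image continuous_fst).isClosed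
  have hsub : ∀ s, Prod.fst '' (X ∩ s) ⊆ K := fun s => hXproj ▸ image_mono inter_subset_left
  obtain ⟨x, -, ⟨⟨_, a⟩, ⟨haX, hat⟩, rfl⟩, ⟨⟨x, b⟩, ⟨hbX, hbt⟩, rfl⟩⟩ :=
    isPreconnected_closed_iff.1 hK.isPreconnected _ _ (hcompact ht) (hcompact ht')
      (by rw [← image_union, ← inter_union_distrib_left, inter_eq_left.2 hcover, hXproj])
      (by rw [inter_eq_right.2 (hsub t)]; exact hne.image _)
      (by rw [inter_eq_right.2 (hsub t')]; exact hne'.image _)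
  have hab : a ≠ b := by
    rintro rfl
    exact hdisj ⟨_, haX, hat, hbt⟩
  let P : X := ⟨(x, a), haX⟩
  let Q : X := ⟨(x, b), hbX⟩
  have hPQ : (P : ConnectedComponents X) ≠ (Q : ConnectedComponents X) := by
    intro h
    have hcc := isPreconnected_closed_iff.1 (isPreconnected_connectedComponent (x := Q))
      _ _ (ht.preimage continuous_subtype_val) (ht'.preimage continuous_subtype_val)
      (fun z _ => hcover z.2) ⟨P, ConnectedComponents.coe_eq_coe'.1 h, hat⟩
      ⟨Q, mem_connectedComponent, hbt⟩
    obtain ⟨z, -, hz⟩ := hcc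
    exact hdisj ⟨z, z.2, hz⟩
  let c : Fin k → ℝ := (2⁻¹ : ℝ) • (a + b)
  let d : Fin k → ℝ := (2⁻¹ : ℝ) • (a - b)
  have hd : d ≠ 0 := smul_ne_zero (by norm_num) (sub_ne_zero.2 hab)
  let ι : (Fin m → ℝ) × (Fin k → ℝ) → (Fin m → ℝ) × (Fin (k + 1) → ℝ) :=
    fun w => (w.1, Fin.cons 0 w.2)
  have hι : Continuous ι := by fun_prop
  obtain ⟨q, hq⟩ := exists_zeroSet_eq_union_fibreEllipse p x c d hd
  rw [← hXdef] at hq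
  have hle := hmin (k + 1) q
  rw [hq] at hle
  change IsCompact (ι '' X ∪ range (fibreEllipse x c d)) →
    Prod.fst '' (ι '' X ∪ range (fibreEllipse x c d)) = K →
    _ ≤ Nat.card (ConnectedComponents ↥(ι '' X ∪ range (fibreEllipse x c d))) at hle
  refine (hle ?_ ?_).not_gt ?_
  · rw [← image_Icc_fibreEllipse]
    exact (hXc.image hι).union (isCompact_Icc.image (continuous_fibreEllipse x c d))
  · rw [image_union, image_image, hXproj, union_eq_left]
    rintro _ ⟨_, ⟨θ, rfl⟩, rfl⟩
    exact hXproj ▸ mem_image_of_mem Prod.fst haX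
  · refine card_connectedComponents_lt_of_curve (P := P) (Q := Q)
      (f := fun w : X => ⟨ι w, .inl (mem_image_of_mem ι w.2)⟩)
      (γ := fun θ => ⟨fibreEllipse x c d θ, .inr (mem_range_self θ)⟩)
      (by fun_prop) ((continuous_fibreEllipse x c d).subtype_mk _) ?_ ⟨0, ?_⟩ ⟨Real.pi, ?_⟩ hPQ
    · rw [eq_univ_iff_forall]
      rintro ⟨_, ⟨w, hw, rfl⟩ | ⟨θ, rfl⟩⟩
      · exact .inl ⟨⟨w, hw⟩, rfl⟩
      · exact .inr ⟨θ, rfl⟩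
    · have : c + d = a := by simp only [c, d]; module
      simp [fibreEllipse, ι, P, this]
    · have : c + -d = b := by simp only [c, d]; module
      simp [fibreEllipse, ι, Q, this]
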